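/- arXiv:math/0508026 — 3 statements merged into one kernel-verified Lean document; each statement's English description precedes it below -/
import Mathlib

section
/- Let f, g : Ω → 𝕂 with ∫ ρ|f|² dμ < ∞ and ∫ ρ|g|² dμ < ∞, and let r > 0 satisfy ∫ ρ(t)|f(t) − g(t)|² dμ(t) ≤ r² < ∫ ρ(t)|g(t)|² dμ(t). Then (∫ ρ|f|² dμ)(∫ ρ|g|² dμ) − |∫ ρ f·conj(g) dμ|² ≤ 2 (∫ ρ|g|² dμ)^{1/2} |∫ ρ f·conj(g) dμ| · [ (∫ ρ|g|² dμ)^{1/2} − (∫ ρ|g|² dμ − r²)^{1/2} ]. -/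
open MeasureTheory

theorem integrable_weight_mul_conj
    {𝕜 Ω : Type*} [RCLike 𝕜] [MeasurableSpace Ω] {μ : Measure Ω}
    {ρ : Ω → ℝ} (hρ : AEStronglyMeasurable ρ μ) (hρ0 : ∀ t, 0 ≤ ρ t) {f g : Ω → 𝕜}
    (hf : AEStronglyMeasurable f μ) (hg : AEStronglyMeasurable g μ)
    (hf2 : Integrable (fun t => ρ t * ‖f t‖ ^ 2) μ)
    (hg2 : Integrable (fun t => ρ t * ‖g t‖ ^ 2) μ) :
    Integrable (fun t => (ρ t : 𝕜) * (f t * starRingEnd 𝕜 (g t))) μ := by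
  refine (hf2.add hg2).mono' ?_ (Filter.Eventually.of_forall fun t => ?_)
  · exact (RCLike.continuous_ofReal.comp_aestronglyMeasurable hρ).mul
      (hf.mul (RCLike.continuous_conj.comp_aestronglyMeasurable hg))
  · have h : ‖f t‖ * ‖g t‖ ≤ ‖f t‖ ^ 2 + ‖g t‖ ^ 2 := by
      nlinarith [sq_nonneg (‖f t‖ - ‖g t‖), sq_nonneg ‖f t‖, sq_nonneg ‖g t‖]
    simpa [abs_of_nonneg (hρ0 t), mul_add] using mul_le_mul_of_nonneg_left h (hρ0 t)

theorem integral_weight_mul_norm_sub_sq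
    {𝕜 Ω : Type*} [RCLike 𝕜] [MeasurableSpace Ω] {μ : Measure Ω}
    {ρ : Ω → ℝ} {f g : Ω → 𝕜}
    (hf2 : Integrable (fun t => ρ t * ‖f t‖ ^ 2) μ)
    (hg2 : Integrable (fun t => ρ t * ‖g t‖ ^ 2) μ)
    (hfg : Integrable (fun t => (ρ t : 𝕜) * (f t * starRingEnd 𝕜 (g t))) μ) :
    ∫ t, ρ t * ‖f t - g t‖ ^ 2 ∂μ =
      (∫ t, ρ t * ‖f t‖ ^ 2 ∂μ) + (∫ t, ρ t * ‖g t‖ ^ 2 ∂μ) -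
        2 * RCLike.re (∫ t, (ρ t : 𝕜) * (f t * starRingEnd 𝕜 (g t)) ∂μ) := by
  rw [← integral_re hfg, ← integral_const_mul, ← integral_add hf2 hg2]
  refine Eq.trans ?_ (integral_sub (hf2.add hg2) (hfg.re.const_mul 2))
  congr 1 with t
  rw [RCLike.re_ofReal_mul, RCLike.norm_sq_eq_def, RCLike.norm_sq_eq_def,
    RCLike.norm_sq_eq_def]
  simp only [map_sub, RCLike.mul_re, RCLike.conj_re, RCLike.conj_im]
  ring

theorem schwarz_reverse_dragomir_16
    {𝕜 Ω : Type*} [RCLike 𝕜] [MeasurableSpace Ω] (μ : Measure Ω)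
    (ρ : Ω → ℝ) (hρ : Measurable ρ) (hρ0 : ∀ t, 0 ≤ ρ t)
    (f g : Ω → 𝕜)
    (hf : AEStronglyMeasurable f μ) (hg : AEStronglyMeasurable g μ)
    (hf2 : Integrable (fun t => ρ t * ‖f t‖ ^ 2) μ)
    (hg2 : Integrable (fun t => ρ t * ‖g t‖ ^ 2) μ)
    (r : ℝ) (hr : 0 < r)
    (h1 : ∫ t, ρ t * ‖f t - g t‖ ^ 2 ∂μ ≤ r ^ 2)
    (h2 : r ^ 2 < ∫ t, ρ t * ‖g t‖ ^ 2 ∂μ) :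
    (∫ t, ρ t * ‖f t‖ ^ 2 ∂μ) * (∫ t, ρ t * ‖g t‖ ^ 2 ∂μ) -
        ‖∫ t, (ρ t : 𝕜) * (f t * starRingEnd 𝕜 (g t)) ∂μ‖ ^ 2 ≤
      2 * Real.sqrt (∫ t, ρ t * ‖g t‖ ^ 2 ∂μ) *
          ‖∫ t, (ρ t : 𝕜) * (f t * starRingEnd 𝕜 (g t)) ∂μ‖ *
        (Real.sqrt (∫ t, ρ t * ‖g t‖ ^ 2 ∂μ) -
          Real.sqrt ((∫ t, ρ t * ‖g t‖ ^ 2 ∂μ) - r ^ 2)) := by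
  have hfg := integrable_weight_mul_conj hρ.aestronglyMeasurable hρ0 hf hg hf2 hg2
  rw [integral_weight_mul_norm_sub_sq hf2 hg2 hfg] at h1
  have hre := RCLike.re_le_norm (∫ t, (ρ t : 𝕜) * (f t * starRingEnd 𝕜 (g t)) ∂μ)
  set A := ∫ t, ρ t * ‖f t‖ ^ 2 ∂μ
  set G := ∫ t, ρ t * ‖g t‖ ^ 2 ∂μ
  set P := ‖∫ t, (ρ t : 𝕜) * (f t * starRingEnd 𝕜 (g t)) ∂μ‖
  have hG : 0 ≤ G := (sq_nonneg r).trans h2.le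
  have hs := Real.sq_sqrt (sub_nonneg.2 h2.le)
  have hq := Real.sq_sqrt hG
  set s := √(G - r ^ 2)
  set q := √G
  have hA : A ≤ 2 * P - s ^ 2 := by linarith
  calc A * G - P ^ 2 ≤ (2 * P - s ^ 2) * G - P ^ 2 := by gcongr
    _ = 2 * q * P * (q - s) - (P - q * s) ^ 2 := by rw [← hq]; ring
    _ ≤ 2 * q * P * (q - s) := sub_le_self _ (sq_nonneg _)
end

section
/- Let f, g : Ω → ℝ be nonnegative with ∫ ρ f² dμ < ∞ and ∫ ρ g² dμ < ∞, and let M ≥ m > 0 satisfy 0 < m ≤ f(t)/g(t) ≤ M and g(t) ≠ 0 for μ-a.e. t ∈ Ω. Then (∫ ρ f² dμ)(∫ ρ g² dμ) − (∫ ρ f g dμ)² ≤ (√M − √m)² (∫ ρ f g dμ)(∫ ρ g² dμ). -/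
open MeasureTheory

theorem schwarz_reverse_dragomir_18
    {Ω : Type*} [MeasurableSpace Ω] (μ : Measure Ω)
    (ρ : Ω → ℝ) (hρ : Measurable ρ) (hρ0 : ∀ t, 0 ≤ ρ t)
    (f g : Ω → ℝ)
    (hf : AEStronglyMeasurable f μ) (hg : AEStronglyMeasurable g μ)
    (hf0 : ∀ t, 0 ≤ f t) (hg0 : ∀ t, 0 ≤ g t)
    (hf2 : Integrable (fun t => ρ t * (f t) ^ 2) μ)
    (hg2 : Integrable (fun t => ρ t * (g t) ^ 2) μ)
    (m M : ℝ) (hm : 0 < m) (hmM : m ≤ M)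
    (hbound : ∀ᵐ t ∂μ, g t ≠ 0 ∧ m ≤ f t / g t ∧ f t / g t ≤ M) :
    (∫ t, ρ t * (f t) ^ 2 ∂μ) * (∫ t, ρ t * (g t) ^ 2 ∂μ) -
        (∫ t, ρ t * (f t * g t) ∂μ) ^ 2 ≤
      (Real.sqrt M - Real.sqrt m) ^ 2 * (∫ t, ρ t * (f t * g t) ∂μ) *
        ∫ t, ρ t * (g t) ^ 2 ∂μ := by
  have hfg : Integrable (fun t => ρ t * (f t * g t)) μ := by
    refine (hf2.add hg2).mono' (hρ.aestronglyMeasurable.mul (hf.mul hg)) (ae_of_all _ fun t => ?_)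
    rw [Real.norm_of_nonneg (mul_nonneg (hρ0 t) (mul_nonneg (hf0 t) (hg0 t))), Pi.add_apply,
      ← mul_add]
    exact mul_le_mul_of_nonneg_left
      (by nlinarith [sq_nonneg (f t - g t), sq_nonneg (f t), sq_nonneg (g t)]) (hρ0 t)
  have hlin : (∫ t, ρ t * (f t) ^ 2 ∂μ) + m * M * (∫ t, ρ t * (g t) ^ 2 ∂μ) ≤
      (M + m) * ∫ t, ρ t * (f t * g t) ∂μ := by
    rw [← integral_const_mul, ← integral_const_mul, ← integral_add hf2 (hg2.const_mul _)]
    refine integral_mono_ae (hf2.add (hg2.const_mul _)) (hfg.const_mul _) ?_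
    filter_upwards [hbound] with t ⟨hgt, hmt, hMt⟩
    have hpos : 0 < g t := lt_of_le_of_ne (hg0 t) hgt.symm
    rw [le_div_iff₀ hpos] at hmt
    rw [div_le_iff₀ hpos] at hMt
    have hprod := mul_nonneg (hρ0 t) (mul_nonneg (sub_nonneg.2 hmt) (sub_nonneg.2 hMt))
    linarith
  have hC : 0 ≤ ∫ t, ρ t * (g t) ^ 2 ∂μ :=
    integral_nonneg fun t => mul_nonneg (hρ0 t) (sq_nonneg _)
  have hm2 := Real.sq_sqrt hm.le
  have hM2 := Real.sq_sqrt (hm.le.trans hmM)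
  generalize (∫ t, ρ t * (f t) ^ 2 ∂μ) = A at *
  generalize (∫ t, ρ t * (g t) ^ 2 ∂μ) = C at *
  generalize (∫ t, ρ t * (f t * g t) ∂μ) = B at *
  generalize Real.sqrt m = a at *
  generalize Real.sqrt M = b at *
  subst hm2 hM2
  linarith [mul_le_mul_of_nonneg_right hlin hC, sq_nonneg (B - a * b * C)]
end

section
/- Let n ∈ ℕ and let x_k, y_k, w_k ≥ 0 (k = 1, …, n) be real numbers with y_k > 0 for all k, and let M ≥ m > 0 satisfy m ≤ x_k / y_k ≤ M for each k. If Σ_{k=1}^n w_k x_k y_k > 0 and Σ_{k=1}^n w_k y_k² > 0, then (Σ_{k=1}^n w_k x_k²)/(Σ_{k=1}^n w_k x_k y_k) − (Σ_{k=1}^n w_k x_k y_k)/(Σ_{k=1}^n w_k y_k²) ≤ (√M − √m)². -/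
/-- Weighted form of the Diaz–Metcalf inequality. -/
theorem sum_mul_sq_add_le_of_mul_le {ι : Type*} (s : Finset ι) {x y w : ι → ℝ} {m M : ℝ}
    (hw : ∀ k ∈ s, 0 ≤ w k) (hm : ∀ k ∈ s, m * y k ≤ x k) (hM : ∀ k ∈ s, x k ≤ M * y k) :
    ∑ k ∈ s, w k * x k ^ 2 + M * m * ∑ k ∈ s, w k * y k ^ 2 ≤
      (M + m) * ∑ k ∈ s, w k * (x k * y k) := by
  rw [Finset.mul_sum, Finset.mul_sum, ← Finset.sum_add_distrib]
  refine Finset.sum_le_sum fun k hk => ?_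
  have h := mul_nonneg (hw k hk)
    (mul_nonneg (sub_nonneg.2 (hm k hk)) (sub_nonneg.2 (hM k hk)))
  linarith


theorem klamkin_mclenaghan
    (n : ℕ) (x y w : Fin n → ℝ)
    (hx : ∀ k, 0 ≤ x k) (hy : ∀ k, 0 < y k) (hw : ∀ k, 0 ≤ w k)
    (m M : ℝ) (hm : 0 < m) (hmM : m ≤ M)
    (hbound : ∀ k, m ≤ x k / y k ∧ x k / y k ≤ M)
    (hxy : 0 < ∑ k, w k * (x k * y k))
    (hyy : 0 < ∑ k, w k * (y k) ^ 2) :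
    (∑ k, w k * (x k) ^ 2) / (∑ k, w k * (x k * y k)) -
        (∑ k, w k * (x k * y k)) / (∑ k, w k * (y k) ^ 2) ≤
      (Real.sqrt M - Real.sqrt m) ^ 2 := by
  have key := sum_mul_sq_add_le_of_mul_le Finset.univ (fun k _ => hw k)
    (fun k _ => (le_div_iff₀ (hy k)).1 (hbound k).1)
    (fun k _ => (div_le_iff₀ (hy k)).1 (hbound k).2)
  generalize ∑ k, w k * x k ^ 2 = A at *
  generalize ∑ k, w k * (x k * y k) = B at *
  generalize ∑ k, w k * y k ^ 2 = C at *
  rw [← Real.sq_sqrt hm.le, ← Real.sq_sqrt (hm.le.trans hmM)] at key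
  generalize √M = a at *
  generalize √m = b at *
  rw [div_sub_div _ _ hxy.ne' hyy.ne', div_le_iff₀ (mul_pos hxy hyy)]
  linarith [mul_le_mul_of_nonneg_right key hyy.le, sq_nonneg (B - a * b * C)]
end
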